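/- For every x ∈ K, the element u(x) − v(x) − Σ_{i=1}^{p−1} v(t^i·x^{(i)}/i!)·(t^r·θ)^i of L lies in v(x)·t^{pr}·R_L. -/

import Mathlib

/-!
Setting: `p > 2` a prime, `k` a perfect field of characteristic `p`,
`K = k((t))` the field of formal Laurent series, `ord` the `t`-adic valuation
(with `ord 0 = +∞`, encoded below via the predicate `ordGe`),
`L = k(θ)((t))` with `k(θ) = RatFunc k`.
-/

noncomputable section

namespace LFT

variable {F : Type*} [Field F]

/-- The formal derivative of a Laurent series: the coefficient of `t^j` in `lsDeriv x`
is `(j+1)` times the coefficient of `t^{j+1}` in `x`. -/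
def lsDeriv (x : LaurentSeries F) : LaurentSeries F where
  coeff j := (j + 1) • x.coeff (j + 1)
  isPWO_support' := by
    have h : Function.support (fun j : ℤ => (j + 1) • x.coeff (j + 1)) ⊆
        (fun j : ℤ => j - 1) '' Function.support x.coeff := by
      intro j hj
      refine ⟨j + 1, ?_, by ring⟩
      intro h0
      simp [Function.mem_support, h0] at hj
    exact (x.isPWO_support'.image_of_monotone (fun a b hab => by omega)).mono h

/-- The uniformizer `t` of `F((t))`. -/
def tt : LaurentSeries F := HahnSeries.single 1 1

/-- `ordGe x N` means `ord x ≥ N`, with the convention `ord 0 = +∞`. -/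
def ordGe (x : LaurentSeries F) (N : ℤ) : Prop := x = 0 ∨ N ≤ x.order

/-- The element `θ` of `k(θ) ⊆ k(θ)((t))`. -/
def θθ (k : Type*) [Field k] : LaurentSeries (RatFunc k) := HahnSeries.single 0 RatFunc.X

/-- Membership in the level `N` of the Kato filtration `fil_N W_{m+1}(F((t)))`:
`p^{m-i}·ord(a_i) ≥ -N` for all `0 ≤ i ≤ m` (with `ord 0 = +∞`). -/
def inFil (p : ℕ) {m : ℕ} (N : ℤ) (a : TruncatedWittVector p (m + 1) (LaurentSeries F)) : Prop :=
  ∀ i : Fin (m + 1), a.coeff i = 0 ∨ -N ≤ (p : ℤ) ^ (m - (i : ℕ)) * (a.coeff i).order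

/-- `α(a) = Σ_{i=0}^m a_i^{p^{m-i}-1}·a_i'`, so that `F^m d(a) = α(a)·dt`. -/
def alphaW (p : ℕ) {m : ℕ} (a : TruncatedWittVector p (m + 1) (LaurentSeries F)) :
    LaurentSeries F :=
  ∑ i : Fin (m + 1), a.coeff i ^ (p ^ (m - (i : ℕ)) - 1) * lsDeriv (a.coeff i)

/-- The componentwise map `W_{m+1}(f)` on truncated Witt vectors induced by `f`. -/
def mapTW (p : ℕ) {m : ℕ} {K L : Type*} (f : K → L)
    (a : TruncatedWittVector p (m + 1) K) : TruncatedWittVector p (m + 1) L :=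
  TruncatedWittVector.mk p fun i => f (a.coeff i)

/-- `V^m(z) = (0, …, 0, z)` in `W_{m+1}(L)`. -/
def Vm (p : ℕ) {m : ℕ} {L : Type*} [Zero L] (z : L) : TruncatedWittVector p (m + 1) L :=
  TruncatedWittVector.mk p fun i => if (i : ℕ) = m then z else 0


theorem ordGe_iff {x : LaurentSeries F} {N : ℤ} : ordGe x N ↔ ∀ j < N, x.coeff j = 0 := by
  unfold ordGe
  by_cases h : x = 0
  · simp [h]
  · simp only [h, false_or]
    exact HahnSeries.le_order_iff_forall h

theorem ordGe.add {x y : LaurentSeries F} {N : ℤ} (hx : ordGe x N) (hy : ordGe y N) :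
    ordGe (x + y) N := by
  rw [ordGe_iff] at *
  intro j hj
  simp [hx j hj, hy j hj]

theorem ordGe.sub {x y : LaurentSeries F} {N : ℤ} (hx : ordGe x N) (hy : ordGe y N) :
    ordGe (x - y) N := by
  rw [ordGe_iff] at *
  intro j hj
  simp [hx j hj, hy j hj]

theorem ordGe.sum {ι : Type*} {s : Finset ι} {f : ι → LaurentSeries F} {N : ℤ}
    (h : ∀ i ∈ s, ordGe (f i) N) : ordGe (∑ i ∈ s, f i) N := by
  classical
  induction s using Finset.induction_on with
  | empty => left; simp
  | insert a s ha ih =>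
    rw [Finset.sum_insert ha]
    exact (h a (by simp)).add (ih fun i hi => h i (by simp [hi]))

theorem ordGe.mono {x : LaurentSeries F} {N M : ℤ} (hx : ordGe x N) (h : M ≤ N) :
    ordGe x M := hx.imp id h.trans

theorem ordGe.mul {x y : LaurentSeries F} {N M : ℤ} (hx : ordGe x N) (hy : ordGe y M) :
    ordGe (x * y) (N + M) := by
  rcases hx with rfl | hx
  · left; simp
  rcases hy with rfl | hy
  · left; simp
  by_cases h : x = 0
  · left; simp [h]
  by_cases h' : y = 0
  · left; simp [h']
  right
  rw [HahnSeries.order_mul h h']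
  omega

theorem ordGe_one : ordGe (1 : LaurentSeries F) 0 := by right; simp

theorem ordGe.pow {x : LaurentSeries F} {N : ℤ} (hx : ordGe x N) (n : ℕ) :
    ordGe (x ^ n) (n * N) := by
  induction n with
  | zero => simpa using ordGe_one
  | succ n ih =>
    rw [pow_succ]
    exact (ih.mul hx).mono (by push_cast; linarith)

theorem ordGe_intCast (m : ℤ) : ordGe (m : LaurentSeries F) 0 := by
  rw [ordGe_iff]
  intro j hj
  have : (m : LaurentSeries F) = HahnSeries.C (m : F) := by simp
  rw [this, HahnSeries.C_apply, HahnSeries.coeff_single_of_ne hj.ne]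

theorem tt_pow (n : ℕ) : (tt : LaurentSeries F) ^ n = HahnSeries.single (n : ℤ) 1 := by
  simp [tt, HahnSeries.single_pow]

theorem ordGe_tt : ordGe (tt : LaurentSeries F) 1 := by
  right; simp [tt]

theorem ordGe_theta (k : Type*) [Field k] : ordGe (θθ k) 0 := by
  right; simp [θθ, RatFunc.X_ne_zero]

theorem coeff_iter (x : LaurentSeries F) (i : ℕ) (j : ℤ) :
    (lsDeriv^[i] x).coeff j = ((descPochhammer ℤ i).eval (j + i)) • x.coeff (j + i) := by
  induction i generalizing j with
  | zero => simp
  | succ i ih =>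
    rw [Function.iterate_succ_apply']
    change (j + 1) • (lsDeriv^[i] x).coeff (j + 1) = _
    rw [ih, smul_smul, descPochhammer_succ_right]
    have : j + ((i + 1 : ℕ) : ℤ) = j + 1 + i := by push_cast; ring
    rw [this]
    congr 1
    simp
    ring

/-- The divided Taylor operator. -/
def TT (i : ℕ) (x : LaurentSeries F) : LaurentSeries F :=
  tt ^ i * lsDeriv^[i] x / (Nat.factorial i : LaurentSeries F)

theorem coeff_TT (p : ℕ) (hp : p.Prime) [CharP F p] (i : ℕ) (hi : i < p)
    (x : LaurentSeries F) (j : ℤ) :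
    (TT i x).coeff j = (Ring.choose j i) • x.coeff j := by
  have hf : ((Nat.factorial i : ℕ) : F) ≠ 0 := by
    rw [Ne, CharP.cast_eq_zero_iff F p, hp.dvd_factorial]
    omega
  have hC : ((Nat.factorial i : ℕ) : LaurentSeries F) = HahnSeries.C ((Nat.factorial i : ℕ) : F) := by
    simp
  have hf' : ((Nat.factorial i : ℕ) : LaurentSeries F) ≠ 0 := by
    rw [hC]; exact HahnSeries.C_ne_zero hf
  have h1 : HahnSeries.C ((Nat.factorial i : ℕ) : F) * TT i x = tt ^ i * lsDeriv^[i] x := by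
    rw [← hC, TT, mul_div_cancel₀ _ hf']
  have h2 := congrArg (fun y => HahnSeries.coeff y j) h1
  simp only [HahnSeries.C_mul_eq_smul, HahnSeries.coeff_smul, tt_pow,
    HahnSeries.coeff_single_mul, coeff_iter, one_mul, sub_add_cancel] at h2
  apply mul_left_cancel₀ hf
  rw [smul_eq_mul] at h2
  rw [h2, Polynomial.eval_eq_smeval, Ring.descPochhammer_eq_factorial_smul_choose]
  simp
  ring

theorem binom_step {A : Type*} [CommRing A] (a : A) (n : ℤ) (q : ℕ) :
    ∑ i ∈ Finset.range (q + 1), ((Ring.choose (n + 1) i : ℤ) : A) * a ^ i =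
      (1 + a) * ∑ i ∈ Finset.range (q + 1), ((Ring.choose n i : ℤ) : A) * a ^ i
        - ((Ring.choose n q : ℤ) : A) * a ^ (q + 1) := by
  induction q with
  | zero => simp
  | succ q ih =>
    rw [Finset.sum_range_succ, ih, Finset.sum_range_succ _ (q + 1), Ring.choose_succ_succ]
    push_cast
    ring

theorem ordGe_inv {x : LaurentSeries F} (hx : x.coeff 0 ≠ 0) : ordGe x⁻¹ 0 := by
  have h0 : x ≠ 0 := by rintro rfl; simp at hx
  right
  have h1 := HahnSeries.order_mul h0 (inv_ne_zero h0)
  rw [mul_inv_cancel₀ h0, HahnSeries.order_one] at h1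
  have := HahnSeries.order_le_of_coeff_ne_zero hx
  omega

theorem binom_ord (a : LaurentSeries F) (r : ℕ) (hr : 1 ≤ r) (ha : ordGe a r) (q : ℕ) (n : ℤ) :
    ordGe ((1 + a) ^ n - ∑ i ∈ Finset.range (q + 1), ((Ring.choose n i : ℤ) : LaurentSeries F) * a ^ i)
      (((q + 1) * r : ℕ) : ℤ) := by
  have hc : (1 + a).coeff 0 ≠ 0 := by
    rw [HahnSeries.coeff_add, ordGe_iff.1 ha 0 (by omega)]
    simp
  have h0 : 1 + a ≠ 0 := by intro h; simp [h] at hc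
  have h1 : ordGe (1 + a) 0 := ordGe_one.add (ha.mono (by omega))
  have hq : ∀ n : ℤ, ordGe (((Ring.choose n q : ℤ) : LaurentSeries F) * a ^ (q + 1))
      (((q + 1) * r : ℕ) : ℤ) := fun n =>
    ((ordGe_intCast _).mul (ha.pow (q + 1))).mono (by push_cast; linarith)
  induction n using Int.induction_on with
  | zero =>
    left
    rw [Finset.sum_range_succ']
    simp
  | succ n ih =>
    rw [binom_step, zpow_add_one₀ h0]
    have h2 := h1.mul ih
    rw [zero_add] at h2
    convert h2.add (hq n) using 1
    ring
  | pred n ih =>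
    have hs := binom_step a (-(n : ℤ) - 1) q
    rw [sub_add_cancel] at hs
    rw [hs] at ih
    have h2 := (ordGe_inv hc).mul (ih.sub (hq (-(n : ℤ) - 1)))
    rw [zero_add] at h2
    convert h2 using 1
    rw [zpow_sub_one₀ h0]
    field_simp
    ring

/-- For every `x ∈ K`, the element
`u(x) − v(x) − Σ_{i=1}^{p−1} v(t^i·x^{(i)}/i!)·(t^r·θ)^i` of `L` lies in `v(x)·t^{pr}·R_L`. -/
theorem statement5 (p : ℕ) (hp : p.Prime) (hp2 : 2 < p)
    (k : Type*) [Field k] [PerfectField k] [CharP k p]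
    (r : ℕ) (hr : 1 ≤ r)
    (u v : LaurentSeries k →+* LaurentSeries (RatFunc k))
    (hv : ∀ (x : LaurentSeries k) (j : ℤ),
      (v x).coeff j = algebraMap k (RatFunc k) (x.coeff j))
    (hu_alg : ∀ c : k,
      u (HahnSeries.single 0 c) = HahnSeries.single 0 (algebraMap k (RatFunc k) c))
    (hu_t : u tt = tt * (1 + tt ^ r * θθ k))
    (hu_cont : ∀ N : ℤ, ∃ M : ℤ, ∀ x : LaurentSeries k, ordGe x M → ordGe (u x) N)
    (x : LaurentSeries k) :
    ∃ w : LaurentSeries (RatFunc k), ordGe w 0 ∧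
      u x - v x - ∑ i ∈ Finset.Icc 1 (p - 1),
          v (tt ^ i * lsDeriv^[i] x / (Nat.factorial i : LaurentSeries k)) *
            ((tt : LaurentSeries (RatFunc k)) ^ r * θθ k) ^ i
        = v x * (tt : LaurentSeries (RatFunc k)) ^ (p * r) * w := by
  have : Fact p.Prime := ⟨hp⟩
  set a : LaurentSeries (RatFunc k) := tt ^ r * θθ k with ha_def
  have ha : ordGe a r := by
    have := (ordGe_tt.pow r).mul (ordGe_theta k)
    simpa using this
  have ha0 : ordGe a 0 := ha.mono (by omega)
  let E : LaurentSeries k → LaurentSeries (RatFunc k) := fun x =>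
    u x - v x - ∑ i ∈ Finset.Icc 1 (p - 1), v (TT i x) * a ^ i
  have hTadd : ∀ i ∈ Finset.Icc 1 (p - 1), ∀ x y : LaurentSeries k,
      TT i (x + y) = TT i x + TT i y := by
    intro i hi x y
    have hi' : i < p := by have := Finset.mem_Icc.1 hi; omega
    ext j
    simp [coeff_TT p hp i hi', mul_add]
  have hEadd : ∀ x y, E (x + y) = E x + E y := by
    intro x y
    have : ∑ i ∈ Finset.Icc 1 (p - 1), v (TT i (x + y)) * a ^ i =
        ∑ i ∈ Finset.Icc 1 (p - 1), v (TT i x) * a ^ i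
        + ∑ i ∈ Finset.Icc 1 (p - 1), v (TT i y) * a ^ i := by
      rw [← Finset.sum_add_distrib]
      refine Finset.sum_congr rfl fun i hi => ?_
      rw [hTadd i hi, map_add, add_mul]
    simp only [E, this, map_add]
    ring
  have hvord : ∀ (x : LaurentSeries k) (N : ℤ), ordGe x N → ordGe (v x) N := by
    intro x N hx
    rw [ordGe_iff] at *
    intro j hj
    rw [hv, hx j hj, map_zero]
  have htail : ∀ N : ℤ, ∃ M : ℤ, ∀ x, ordGe x M → ordGe (E x) N := by
    intro N
    obtain ⟨M, hM⟩ := hu_cont N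
    refine ⟨max M N, fun x hx => ?_⟩
    have hxN : ordGe x N := hx.mono (le_max_right _ _)
    refine ((hM x (hx.mono (le_max_left _ _))).sub (hvord x N hxN)).sub (ordGe.sum fun i hi => ?_)
    have hi' : i < p := by have := Finset.mem_Icc.1 hi; omega
    have hT : ordGe (TT i x) N := by
      rw [ordGe_iff] at *
      intro j hj
      rw [coeff_TT p hp i hi', hxN j hj, smul_zero]
    have := (hvord _ _ hT).mul (ha0.pow i)
    simpa using this
  have hmono : ∀ (n : ℤ) (c : k), ordGe (E (HahnSeries.single n c)) (n + (p * r : ℕ)) := by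
    intro n c
    have hvs : v (HahnSeries.single n c) = HahnSeries.single n (algebraMap k (RatFunc k) c) := by
      ext j
      rw [hv]
      by_cases hj : j = n
      · simp [hj]
      · simp [HahnSeries.coeff_single_of_ne hj]
    have hsing : (HahnSeries.single n c : LaurentSeries k) = HahnSeries.single 0 c * tt ^ n := by
      rw [tt, ← RatFunc.single_zpow, HahnSeries.single_mul_single]
      simp
    have hus : u (HahnSeries.single n c) = v (HahnSeries.single n c) * (1 + a) ^ n := by
      rw [hvs, hsing, map_mul, map_zpow₀, hu_alg, hu_t, mul_zpow, ← mul_assoc]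
      rw [tt, ← RatFunc.single_zpow, HahnSeries.single_mul_single]
      simp
    have hvT : ∀ i ∈ Finset.Icc 1 (p - 1), v (TT i (HahnSeries.single n c)) * a ^ i =
        v (HahnSeries.single n c) * (((Ring.choose n i : ℤ) : LaurentSeries (RatFunc k)) * a ^ i) := by
      intro i hi
      have hi' : i < p := by have := Finset.mem_Icc.1 hi; omega
      have : TT i (HahnSeries.single n c : LaurentSeries k) =
          ((Ring.choose n i : ℤ) : LaurentSeries k) * HahnSeries.single n c := by
        ext j
        rw [coeff_TT p hp i hi', ← zsmul_eq_mul, HahnSeries.coeff_smul]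
        by_cases hj : j = n
        · rw [hj]
        · simp [HahnSeries.coeff_single_of_ne hj]
      rw [this, map_mul, map_intCast]
      ring
    have hE : E (HahnSeries.single n c) = v (HahnSeries.single n c) *
        ((1 + a) ^ n - ∑ i ∈ Finset.range (p - 1 + 1),
          ((Ring.choose n i : ℤ) : LaurentSeries (RatFunc k)) * a ^ i) := by
      have hr : Finset.range (p - 1 + 1) = insert 0 (Finset.Icc 1 (p - 1)) := by
        ext i; simp; omega
      simp only [E]
      rw [Finset.sum_congr rfl hvT, ← Finset.mul_sum, hus, hr, Finset.sum_insert (by simp)]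
      simp
      ring
    rw [hE]
    have hp1 : p - 1 + 1 = p := by omega
    have hb := binom_ord a r hr ha (p - 1) n
    have hs : ordGe (v (HahnSeries.single n c)) n := by
      apply hvord
      rw [ordGe_iff]
      intro j hj
      exact HahnSeries.coeff_single_of_ne hj.ne
    have := hs.mul hb
    rwa [hp1] at this ⊢
  have hmain : ∀ (n : ℤ) (x : LaurentSeries k), ordGe x n → ordGe (E x) (n + (p * r : ℕ)) := by
    intro n
    obtain ⟨M, hM⟩ := htail (n + (p * r : ℕ))
    have key : ∀ d : ℕ, ∀ x, ordGe x (M - d) → n ≤ M - d → ordGe (E x) (n + (p * r : ℕ)) := by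
      intro d
      induction d with
      | zero => intro x hx _; exact hM x (by simpa using hx)
      | succ d ih =>
        intro x hx hn
        push_cast at hx hn
        set m : ℤ := M - (d + 1) with hm
        have hx' : x = HahnSeries.single m (x.coeff m) + (x - HahnSeries.single m (x.coeff m)) := by
          ring
        rw [hx', hEadd]
        refine ((hmono m _).mono (by omega)).add (ih _ ?_ (by omega))
        rw [ordGe_iff] at *
        intro j hj
        rw [HahnSeries.coeff_sub]
        by_cases hjm : j = m
        · simp [hjm]
        · rw [HahnSeries.coeff_single_of_ne hjm, hx j (by omega), sub_zero]
    intro x hx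
    by_cases h : n ≤ M
    · exact key (M - n).toNat x (hx.mono (by omega)) (by omega)
    · exact hM x (hx.mono (by omega))
  have hEx := hmain x.order x (Or.inr le_rfl)
  change ∃ w : LaurentSeries (RatFunc k), ordGe w 0 ∧ E x = v x * tt ^ (p * r) * w
  by_cases hx : x = 0
  · refine ⟨0, Or.inl rfl, ?_⟩
    have := hEadd 0 0
    rw [add_zero] at this
    rw [hx, mul_zero]
    exact left_eq_add.1 this
  have hvx : v x ≠ 0 := (map_ne_zero v).2 hx
  have htt : (tt : LaurentSeries (RatFunc k)) ^ (p * r) ≠ 0 := by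
    rw [tt_pow]; simp
  have hprod := mul_ne_zero hvx htt
  refine ⟨E x / (v x * tt ^ (p * r)), ?_, (mul_div_cancel₀ _ hprod).symm⟩
  rcases hEx with h0 | hord
  · left; rw [h0, zero_div]
  by_cases h0 : E x = 0
  · left; rw [h0, zero_div]
  right
  have h1 := HahnSeries.order_mul hprod (div_ne_zero h0 hprod)
  rw [mul_div_cancel₀ _ hprod, HahnSeries.order_mul hvx htt, tt_pow,
    HahnSeries.order_single one_ne_zero] at h1
  have h2 : (v x).order ≤ x.order := by
    apply HahnSeries.order_le_of_coeff_ne_zero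
    rw [hv]
    simpa using hx
  rw [tt_pow]
  omega


end LFT
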